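/- arXiv:2602.10836 — 3 statements merged into one kernel-verified Lean document; each statement's English description precedes it below -/
import Mathlib

section
/- Let v ∈ ℝ³ be a fixed vector and let b : ℝ³ → ℝ³ be a C¹ vector field with |b(x)| = 1 for all x ∈ ℝ³. Then for every x ∈ ℝ³ one has (Db(x)·(v × b(x))) × (v × b(x)) = [ (b(x)·v)(v·curl b(x)) − |v|² (b(x)·curl b(x)) − (∇_v b)(x)·(v × b(x)) ] · b(x), where Db(x)·w = (∇_w b)(x) denotes the directional derivative of b at x in direction w. -/
open MeasureTheory Filter RealInnerProductSpace

noncomputable section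

abbrev E3 := EuclideanSpace ℝ (Fin 3)

/-- Cross product on `E3`. -/
def cross (u v : E3) : E3 :=
  !₂[u 1 * v 2 - u 2 * v 1, u 2 * v 0 - u 0 * v 2, u 0 * v 1 - u 1 * v 0]

/-- Partial derivative of `f` in the `i`-th coordinate direction. -/
def pd (f : E3 → E3) (i : Fin 3) (x : E3) : E3 := fderiv ℝ f x (EuclideanSpace.single i 1)

/-- Curl of a vector field. -/
def curl (f : E3 → E3) (x : E3) : E3 :=
  !₂[pd f 1 x 2 - pd f 2 x 1, pd f 2 x 0 - pd f 0 x 2, pd f 0 x 1 - pd f 1 x 0]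

/-- Divergence of a vector field. -/
def divergence (f : E3 → E3) (x : E3) : ℝ := ∑ i, pd f i x i

lemma inner_eq_sum_coords (u w : E3) : ⟪u, w⟫ = u 0 * w 0 + u 1 * w 1 + u 2 * w 2 := by
  simp [PiLp.inner_apply, Fin.sum_univ_three, mul_comm]

/-- The vector triple product `v × (v × b)`. -/
lemma cross_self_cross (v b : E3) : cross v (cross v b) = ⟪b, v⟫ • v - ‖v‖ ^ 2 • b := by
  rw [← real_inner_self_eq_norm_sq, inner_eq_sum_coords v v]
  ext i
  fin_cases i <;> simp [cross, inner_eq_sum_coords] <;> ring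

/-- The cross product of two vectors orthogonal to `b` is parallel to `b`. -/
lemma norm_sq_smul_cross_of_orthogonal {u w b : E3} (hu : ⟪u, b⟫ = 0) (hw : ⟪w, b⟫ = 0) :
    ‖b‖ ^ 2 • cross u w = ⟪b, cross u w⟫ • b := by
  rw [← real_inner_self_eq_norm_sq, inner_eq_sum_coords b b]
  rw [inner_eq_sum_coords] at hu hw
  ext i
  fin_cases i <;> simp [cross, inner_eq_sum_coords]
  · linear_combination (b 1 * w 2 - b 2 * w 1) * hu + (b 2 * u 1 - b 1 * u 2) * hw
  · linear_combination (b 2 * w 0 - b 0 * w 2) * hu + (b 0 * u 2 - b 2 * u 0) * hw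
  · linear_combination (b 0 * w 1 - b 1 * w 0) * hu + (b 1 * u 0 - b 0 * u 1) * hw

lemma inner_cross_cross (u v b : E3) :
    ⟪b, cross u (cross v b)⟫ = ⟪b, v⟫ * ⟪u, b⟫ - ‖b‖ ^ 2 * ⟪u, v⟫ := by
  rw [← real_inner_self_eq_norm_sq, inner_eq_sum_coords b b]
  simp [cross, inner_eq_sum_coords]
  ring

lemma inner_cross_self_right (v b : E3) : ⟪cross v b, b⟫ = 0 := by
  simp [cross, inner_eq_sum_coords]
  ring

lemma fderiv_eq_sum_pd (f : E3 → E3) (x p : E3) :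
    fderiv ℝ f x p = p 0 • pd f 0 x + p 1 • pd f 1 x + p 2 • pd f 2 x := by
  have hp : p = p 0 • EuclideanSpace.single 0 1 + p 1 • EuclideanSpace.single 1 1
      + p 2 • EuclideanSpace.single 2 1 := by
    ext i
    fin_cases i <;> simp
  conv_lhs => rw [hp]
  simp only [map_add, map_smul, pd]

/-- The curl is the axial vector of the antisymmetric part of the derivative. -/
lemma inner_cross_curl (f : E3 → E3) (x p q : E3) :
    ⟪cross p q, curl f x⟫ = ⟪fderiv ℝ f x p, q⟫ - ⟪fderiv ℝ f x q, p⟫ := by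
  simp [fderiv_eq_sum_pd, inner_eq_sum_coords, cross, curl]
  ring

/-- The derivative of a field of constant norm is orthogonal to the field. -/
lemma inner_fderiv_of_norm_const {b : E3 → E3} {x : E3} {c : ℝ} (hb : DifferentiableAt ℝ b x)
    (hc : ∀ y, ‖b y‖ = c) (w : E3) : ⟪fderiv ℝ b x w, b x⟫ = 0 := by
  have hconst : (fun y => ⟪b y, b y⟫) = fun _ => c ^ 2 := by
    funext y
    rw [real_inner_self_eq_norm_sq, hc]
  have h := fderiv_inner_apply ℝ hb hb w
  rw [hconst, fderiv_fun_const, real_inner_comm (b x)] at h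
  simp only [Pi.zero_apply, _root_.zero_apply] at h
  linarith [real_inner_comm (b x) (fderiv ℝ b x w)]

/-- Lemma 2.1 (useful identity): for a $C^1$ unit vector field $b$ and fixed $v$,
$(Db(x)\cdot(v\times b))\times(v\times b) = [(b\cdot v)(v\cdot\operatorname{curl} b)
 - |v|^2 (b\cdot\operatorname{curl} b) - \nabla_v b\cdot(v\times b)]\, b$. -/
theorem stmt0 (v : E3) (b : E3 → E3) (hb : ContDiff ℝ 1 b)
    (hunit : ∀ x : E3, ‖b x‖ = 1) (x : E3) :
    cross (fderiv ℝ b x (cross v (b x))) (cross v (b x)) =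
      (⟪b x, v⟫ * ⟪v, curl b x⟫ - ‖v‖ ^ 2 * ⟪b x, curl b x⟫
        - ⟪fderiv ℝ b x v, cross v (b x)⟫) • b x := by
  have horth := inner_fderiv_of_norm_const (hb.differentiable one_ne_zero x) hunit
    (cross v (b x))
  have hpar := norm_sq_smul_cross_of_orthogonal horth (inner_cross_self_right v (b x))
  rw [inner_cross_cross, horth, hunit, one_pow, one_smul] at hpar
  have hcurl := inner_cross_curl b x v (cross v (b x))
  rw [cross_self_cross, inner_sub_left, real_inner_smul_left, real_inner_smul_left] at hcurl
  rw [hpar, hcurl]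
  congr 1
  ring
end
end

section
/- Let v ∈ ℝ³ be a fixed vector and let b : ℝ³ → ℝ³ be a C¹ vector field with |b(x)| = 1 for all x ∈ ℝ³. Then at every point x ∈ ℝ³: (∇_{v×b} b)(x) = (curl b(x) × v) × b(x) − (∇_v b)(x) × b(x) + (div b)(x) (v × b(x)). -/
open MeasureTheory Filter RealInnerProductSpace

noncomputable section

theorem fderiv_apply_eq_sum_pd (f : E3 → E3) (x w : E3) (i : Fin 3) :
    fderiv ℝ f x w i = w 0 * pd f 0 x i + w 1 * pd f 1 x i + w 2 * pd f 2 x i := by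
  have hw : w = w 0 • EuclideanSpace.single 0 1 + w 1 • EuclideanSpace.single 1 1
      + w 2 • (EuclideanSpace.single 2 1 : E3) := by
    ext j
    fin_cases j <;> simp
  conv_lhs => rw [hw]
  simp only [map_add, map_smul, PiLp.add_apply, PiLp.smul_apply, smul_eq_mul, pd]

/-- The derivative of a field of constant norm is pointwise orthogonal to the field. -/
theorem inner_fderiv_eq_zero_of_norm_eq_const {b : E3 → E3} {c : ℝ} {x : E3}
    (hb : DifferentiableAt ℝ b x) (hc : ∀ y, ‖b y‖ = c) (w : E3) :
    ⟪b x, fderiv ℝ b x w⟫ = 0 := by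
  have h := fderiv_inner_apply ℝ hb hb w
  have hconst : (fun y => ⟪b y, b y⟫) = fun _ => c ^ 2 := by
    funext y
    rw [real_inner_self_eq_norm_sq, hc]
  rw [hconst, fderiv_fun_const] at h
  simp only [Pi.zero_apply, zero_apply] at h
  have hcomm := real_inner_comm (b x) (fderiv ℝ b x w)
  linarith

/-- Identity (2.3): $\nabla_{v\times b}b = (\operatorname{curl} b\times v)\times b
 - \nabla_v b\times b + \operatorname{div}(b)\,(v\times b)$ for a $C^1$ unit field $b$. -/
theorem stmt1 (v : E3) (b : E3 → E3) (hb : ContDiff ℝ 1 b)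
    (hunit : ∀ x : E3, ‖b x‖ = 1) (x : E3) :
    fderiv ℝ b x (cross v (b x)) =
      cross (cross (curl b x) v) (b x) - cross (fderiv ℝ b x v) (b x)
        + divergence b x • cross v (b x) := by
  have orth (j : Fin 3) :
      b x 0 * pd b j x 0 + b x 1 * pd b j x 1 + b x 2 * pd b j x 2 = 0 := by
    have h := inner_fderiv_eq_zero_of_norm_eq_const (hb.differentiable one_ne_zero x) hunit
      (EuclideanSpace.single j 1)
    simp only [PiLp.inner_apply, Fin.sum_univ_three, RCLike.inner_apply, conj_trivial] at h
    simp only [pd]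
    linarith
  have h0 := orth 0
  have h1 := orth 1
  have h2 := orth 2
  ext i
  fin_cases i <;>
    simp [fderiv_apply_eq_sum_pd, cross, curl, divergence, Fin.sum_univ_three]
  · linear_combination v 2 * h1 - v 1 * h2
  · linear_combination v 0 * h2 - v 2 * h0
  · linear_combination v 1 * h0 - v 0 * h1
end
end

section
/- With h as in the zero order guiding-centre limit, the parallel velocity components h_ω(t) := b(x_ω(t))·v_ω(t) converge to h in C^{0,α}_loc(ℝ) for every 0 ≤ α < 1 as ω → ∞, i.e., for every compact K ⊂ ℝ the α-Hölder norm of h_ω − h on K tends to 0. -/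
open MeasureTheory Filter RealInnerProductSpace

noncomputable section

/-- Convergence in $C^{0,\alpha}_{loc}$ as $\omega\to\infty$: for every compact
$K\subset\mathbb{R}$ the $\alpha$-Hölder norm of $f_\omega - g$ on $K$ tends to $0$
(both the sup part and the Hölder seminorm part become arbitrarily small). -/
def HolderLocConv {E : Type*} [NormedAddCommGroup E] (f : ℝ → ℝ → E) (g : ℝ → E)
    (α : ℝ) : Prop :=
  ∀ K : Set ℝ, IsCompact K → ∀ ε > 0, ∃ W : ℝ, ∀ ω ≥ W,
    (∀ t ∈ K, ‖f ω t - g t‖ ≤ ε) ∧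
    ∀ s ∈ K, ∀ t ∈ K, ‖(f ω s - g s) - (f ω t - g t)‖ ≤ ε * |s - t| ^ α
open Set

/-- The vector `cross u v` is orthogonal to `v`. -/
lemma inner_right_cross (u v : E3) : ⟪v, cross u v⟫ = 0 := by
  simp [cross, PiLp.inner_apply, Fin.sum_univ_three]
  ring

/-- The vector `cross u v` is orthogonal to `u`. -/
lemma inner_left_cross (u v : E3) : ⟪u, cross u v⟫ = 0 := by
  simp [cross, PiLp.inner_apply, Fin.sum_univ_three]
  ring

/-- A velocity whose acceleration is always orthogonal to it has constant norm. -/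
lemma norm_eq_of_inner_deriv_eq_zero {E : Type*} [NormedAddCommGroup E] [InnerProductSpace ℝ E]
    {v : ℝ → E} (hv : Differentiable ℝ v) (horth : ∀ t, ⟪v t, deriv v t⟫ = 0) (s t : ℝ) :
    ‖v s‖ = ‖v t‖ := by
  have hd : ∀ t, HasDerivAt (fun t => ‖v t‖ ^ 2) 0 t := fun t => by
    simpa [horth t] using (hv t).hasDerivAt.norm_sq
  have heq := is_const_of_deriv_eq_zero (fun t => (hd t).differentiableAt)
    (fun t => (hd t).deriv) s t
  exact (pow_left_inj₀ (norm_nonneg _) (norm_nonneg _) two_ne_zero).mp heq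

/-- The direction field of a nowhere vanishing field is as smooth as the field. -/
lemma ContDiff.norm_inv_smul {E F : Type*} [NormedAddCommGroup E] [NormedSpace ℝ E]
    [NormedAddCommGroup F] [InnerProductSpace ℝ F] {n : WithTop ℕ∞} {f : E → F}
    (hf : ContDiff ℝ n f) (hne : ∀ y, f y ≠ 0) : ContDiff ℝ n fun y => ‖f y‖⁻¹ • f y :=
  ((hf.norm ℝ hne).inv fun y => norm_ne_zero_iff.mpr (hne y)).smul hf

/-- Interpolation: a bound by `D` and a Lipschitz bound give a Hölder bound. -/
lemma le_mul_rpow_of_le_of_le_mul {A D L d α : ℝ} (hA : 0 ≤ A) (hL : 0 ≤ L) (hd : 0 ≤ d)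
    (hα0 : 0 ≤ α) (hα1 : α < 1) (hAD : A ≤ D) (hAL : A ≤ L * d) :
    A ≤ D ^ (1 - α) * L ^ α * d ^ α := by
  calc A = A ^ (1 - α) * A ^ α := by
        rw [← Real.rpow_add' hA (by norm_num)]; norm_num
    _ ≤ D ^ (1 - α) * (L * d) ^ α := by
        have := sub_pos.mpr hα1
        gcongr
        exact Real.rpow_nonneg (hA.trans hAD) _
    _ = D ^ (1 - α) * L ^ α * d ^ α := by rw [Real.mul_rpow hL hd, mul_assoc]

/-- Locally uniform convergence together with an eventual local Lipschitz bound implies local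
Hölder convergence for all exponents below one. -/
lemma holderLocConv_of_lipschitz {E : Type*} [NormedAddCommGroup E] {f : ℝ → ℝ → E} {g : ℝ → E}
    (hlip : ∀ R : ℝ, ∃ L W : ℝ, ∀ ω ≥ W, ∀ s ∈ Icc (-R) R, ∀ t ∈ Icc (-R) R,
      ‖(f ω s - g s) - (f ω t - g t)‖ ≤ L * |s - t|)
    (hunif : ∀ R : ℝ, ∀ ε > 0, ∃ W : ℝ, ∀ ω ≥ W, ∀ t ∈ Icc (-R) R, ‖f ω t - g t‖ ≤ ε)
    {α : ℝ} (hα0 : 0 ≤ α) (hα1 : α < 1) : HolderLocConv f g α := by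
  intro K hK ε hε
  obtain ⟨R, hR⟩ := hK.isBounded.subset_closedBall 0
  rw [Real.closedBall_eq_Icc, zero_sub, zero_add] at hR
  obtain ⟨L, W₁, hL⟩ := hlip R
  set M := max L 1
  have hM : 0 < M := lt_max_of_lt_right one_pos
  set D := (ε / M ^ α) ^ (1 - α)⁻¹
  have hD : 0 < D := by positivity
  have hDM : D ^ (1 - α) * M ^ α = ε := by
    rw [Real.rpow_inv_rpow (by positivity) (sub_pos.mpr hα1).ne']
    field_simp
  obtain ⟨W₂, hW₂⟩ := hunif R (min ε (D / 2)) (by positivity)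
  refine ⟨max W₁ W₂, fun ω hω => ?_⟩
  have hsmall := hW₂ ω (le_of_max_le_right hω)
  refine ⟨fun t ht => (hsmall t (hR ht)).trans (min_le_left _ _), fun s hs t ht => ?_⟩
  rw [← hDM]
  refine le_mul_rpow_of_le_of_le_mul (norm_nonneg _) hM.le (abs_nonneg _) hα0 hα1 ?_ ?_
  · have h₁ := (hsmall s (hR hs)).trans (min_le_right _ _)
    have h₂ := (hsmall t (hR ht)).trans (min_le_right _ _)
    linarith [norm_sub_le (f ω s - g s) (f ω t - g t)]
  · refine (hL ω (le_of_max_le_left hω) s (hR hs) t (hR ht)).trans ?_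
    gcongr
    exact le_max_left _ _

/-- Landau-type inequality: a Lipschitz function close to the derivative of a small function
is small. -/
lemma abs_le_of_lipschitz_of_near_deriv {q G G' : ℝ → ℝ} {t η L c δ : ℝ} (hη : 0 < η)
    (hL : 0 ≤ L)
    (hG : ∀ s ∈ Icc t (t + η), HasDerivAt G (G' s) s)
    (hq : ∀ s ∈ Icc t (t + η), |q t - q s| ≤ L * |t - s|)
    (hGδ : ∀ s ∈ Icc t (t + η), |G s| ≤ δ)
    (hnear : ∀ s ∈ Icc t (t + η), |q s - G' s| ≤ c) :
    |q t| ≤ L * η + c + 2 * δ / η := by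
  obtain ⟨ξ, hξ, hslope⟩ := exists_hasDerivAt_eq_slope G G' (lt_add_of_pos_right t hη)
    (fun s hs => (hG s hs).continuousAt.continuousWithinAt)
    (fun s hs => hG s (Ioo_subset_Icc_self hs))
  have hξ' := Ioo_subset_Icc_self hξ
  have hG'ξ : |G' ξ| ≤ 2 * δ / η := by
    rw [hslope, add_sub_cancel_left, abs_div, abs_of_pos hη]
    gcongr
    linarith [abs_sub (G (t + η)) (G t), hGδ t (left_mem_Icc.mpr (by linarith)),
      hGδ (t + η) (right_mem_Icc.mpr (by linarith))]
  have hlip : |q t - q ξ| ≤ L * η := by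
    refine (hq ξ hξ').trans ?_
    gcongr
    rw [abs_le]
    constructor <;> linarith [hξ.1, hξ.2]
  calc |q t| = |(q t - q ξ) + (q ξ - G' ξ) + G' ξ| := by ring_nf
    _ ≤ |q t - q ξ| + |q ξ - G' ξ| + |G' ξ| := abs_add_three _ _ _
    _ ≤ _ := by linarith [hnear ξ hξ']

/-- On a compact interval, a `C¹` field has one derivative bound near the limit curve
that serves all curves uniformly within distance one. -/
lemma exists_fderiv_bound_near_curve {E F : Type*} [NormedAddCommGroup E] [NormedSpace ℝ E]
    [ProperSpace E] [NormedAddCommGroup F] [NormedSpace ℝ F] {b : E → F} (hb : ContDiff ℝ 1 b)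
    {x : ℝ → E} (hx : Continuous x) (T : ℝ) :
    ∃ C : ℝ, 0 ≤ C ∧ ∀ t ∈ Icc (-T) T, ∀ y, ‖y - x t‖ ≤ 1 →
      ‖fderiv ℝ b y‖ ≤ C ∧ ‖b y - b (x t)‖ ≤ C * ‖y - x t‖ := by
  obtain ⟨M, hM⟩ := isCompact_Icc.exists_bound_of_continuousOn (hx.continuousOn (s := Icc (-T) T))
  obtain ⟨C, hC⟩ := (isCompact_closedBall (0 : E) (M + 1)).exists_bound_of_continuousOn
    (hb.continuous_fderiv one_ne_zero).continuousOn
  refine ⟨max C 0, le_max_right _ _, fun t ht y hy => ?_⟩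
  have hxt : x t ∈ Metric.closedBall (0 : E) (M + 1) := by
    rw [mem_closedBall_zero_iff]; linarith [hM t ht]
  have hyt : y ∈ Metric.closedBall (0 : E) (M + 1) := by
    rw [mem_closedBall_zero_iff]; linarith [hM t ht, norm_sub_norm_le y (x t)]
  have hC' : ∀ z ∈ Metric.closedBall (0 : E) (M + 1), ‖fderiv ℝ b z‖ ≤ max C 0 :=
    fun z hz => (hC z hz).trans (le_max_left _ _)
  exact ⟨hC' y hyt, (convex_closedBall _ _).norm_image_sub_le_of_norm_fderiv_le
    (fun z _ => hb.differentiable one_ne_zero z) hC' hxt hyt⟩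

/-- The parallel velocity components $h_\omega(t) = b(x_\omega(t))\cdot v_\omega(t)$
converge to $h$ in $C^{0,\alpha}_{loc}(\mathbb{R})$ for every $0\le\alpha<1$. -/
theorem stmt6 (B : E3 → E3) (hB : ContDiff ℝ 2 B) (hne : ∀ y : E3, B y ≠ 0)
    (hdiv : ∀ y : E3, divergence B y = 0) (x₀ v₀ : E3)
    (b : E3 → E3) (hb : b = fun y => ‖B y‖⁻¹ • B y)
    (xω : ℝ → ℝ → E3)
    (hxC : ∀ ω > (0:ℝ), ContDiff ℝ 2 (xω ω))
    (hode : ∀ ω > (0:ℝ), ∀ t : ℝ,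
      deriv (deriv (xω ω)) t = ω • cross (deriv (xω ω) t) (B (xω ω t)))
    (hinit : ∀ ω > (0:ℝ), xω ω 0 = x₀ ∧ deriv (xω ω) 0 = v₀)
    (x : ℝ → E3) (h : ℝ → ℝ) (hx3 : ContDiff ℝ 3 x) (hh2 : ContDiff ℝ 2 h)
    (hconv : ∀ α : ℝ, 0 ≤ α → α < 1 → HolderLocConv xω x α)
    (hxh : ∀ t : ℝ, deriv x t = h t • b (x t)) :
    ∀ α : ℝ, 0 ≤ α → α < 1 →
      HolderLocConv (fun ω t => ⟪b (xω ω t), deriv (xω ω) t⟫) h α := by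
  have hbC : ContDiff ℝ 1 b := by
    rw [hb]; exact (hB.norm_inv_smul hne).of_le one_le_two
  have hbnorm : ∀ y, ‖b y‖ = 1 := fun y => by
    rw [hb]; exact norm_smul_inv_norm (𝕜 := ℝ) (hne y)
  have hvd : ∀ ω > 0, Differentiable ℝ (deriv (xω ω)) := fun ω hω =>
    (ContDiff.deriv' (n := 1) (by simpa only [one_add_one_eq_two] using hxC ω hω)).differentiable
      one_ne_zero
  have hxd : ∀ ω > 0, ∀ t, HasDerivAt (xω ω) (deriv (xω ω) t) t := fun ω hω t =>
    ((hxC ω hω).differentiable two_ne_zero t).hasDerivAt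
  have hvnorm : ∀ ω > 0, ∀ t, ‖deriv (xω ω) t‖ = ‖v₀‖ := fun ω hω t => by
    rw [← (hinit ω hω).2]
    refine norm_eq_of_inner_deriv_eq_zero (hvd ω hω) (fun t => ?_) t 0
    rw [hode ω hω, inner_smul_right, inner_left_cross, mul_zero]
  have hbd : ∀ ω > 0, ∀ t, HasDerivAt (fun t => b (xω ω t))
      (fderiv ℝ b (xω ω t) (deriv (xω ω) t)) t := fun ω hω t =>
    (hbC.differentiable one_ne_zero _).hasFDerivAt.comp_hasDerivAt t (hxd ω hω t)
  have hhd : ∀ ω > 0, ∀ t, HasDerivAt (fun t => ⟪b (xω ω t), deriv (xω ω) t⟫)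
      ⟪fderiv ℝ b (xω ω t) (deriv (xω ω) t), deriv (xω ω) t⟫ t := fun ω hω t => by
    have horth : ⟪b (xω ω t), deriv (deriv (xω ω)) t⟫ = 0 := by
      rw [hode ω hω, hb, inner_smul_right, inner_smul_left, inner_right_cross]
      simp
    simpa [horth] using (hbd ω hω t).inner ℝ (hvd ω hω t).hasDerivAt
  have hclose : ∀ T : ℝ, ∀ ε > 0, ∃ W : ℝ, ∀ ω ≥ W, ∀ t ∈ Icc (-T) T, ‖xω ω t - x t‖ ≤ ε :=
    fun T ε hε => (hconv 0 le_rfl one_pos _ isCompact_Icc ε hε).imp fun W hW ω hω => (hW ω hω).1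
  have hDbv : ∀ ω > 0, ∀ t C, ‖fderiv ℝ b (xω ω t)‖ ≤ C →
      ‖fderiv ℝ b (xω ω t) (deriv (xω ω) t)‖ ≤ C * ‖v₀‖ := fun ω hω t C hC => by
    rw [← hvnorm ω hω t]
    exact ContinuousLinearMap.le_of_opNorm_le _ hC _
  have hlip : ∀ R : ℝ, ∃ L W : ℝ, ∀ ω ≥ W, ∀ s ∈ Icc (-R) R, ∀ t ∈ Icc (-R) R,
      ‖(⟪b (xω ω s), deriv (xω ω) s⟫ - h s) - (⟪b (xω ω t), deriv (xω ω) t⟫ - h t)‖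
        ≤ L * |s - t| := by
    intro R
    obtain ⟨C, -, hC⟩ := exists_fderiv_bound_near_curve hbC hx3.continuous R
    obtain ⟨H, hH⟩ := isCompact_Icc.exists_bound_of_continuousOn
      ((hh2.continuous_deriv one_le_two).continuousOn (s := Icc (-R) R))
    obtain ⟨W, hW⟩ := hclose R 1 one_pos
    refine ⟨C * ‖v₀‖ * ‖v₀‖ + H, max W 1, fun ω hω s hs t ht => ?_⟩
    have hω0 : 0 < ω := one_pos.trans_le (le_of_max_le_right hω)
    refine (convex_Icc (-R) R).norm_image_sub_le_of_norm_hasDerivWithin_le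
      (f := fun t => ⟪b (xω ω t), deriv (xω ω) t⟫ - h t)
      (fun r _ => ((hhd ω hω0 r).sub
        (hh2.differentiable two_ne_zero r).hasDerivAt).hasDerivWithinAt) (fun r hr => ?_) ht hs
    refine (norm_sub_le _ _).trans (add_le_add ?_ (hH r hr))
    refine (norm_inner_le_norm _ _).trans ?_
    rw [hvnorm ω hω0]
    gcongr
    exact hDbv ω hω0 r C (hC r hr _ (hW ω (le_of_max_le_left hω) r hr)).1
  intro α hα0 hα1
  refine holderLocConv_of_lipschitz hlip (fun R ε hε => ?_) hα0 hα1
  obtain ⟨C, hC0, hC⟩ := exists_fderiv_bound_near_curve hbC hx3.continuous (R + 1)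
  obtain ⟨H, hH⟩ := isCompact_Icc.exists_bound_of_continuousOn
    (hh2.continuous.continuousOn (s := Icc (-(R + 1)) (R + 1)))
  obtain ⟨L, W₁, hL⟩ := hlip (R + 1)
  set M := max L 1
  have hM : 0 < M := lt_max_of_lt_right one_pos
  set η := min 1 (ε / (2 * M))
  have hη : 0 < η := by positivity
  have hMη : M * η ≤ ε / 2 := by
    calc M * η ≤ M * (ε / (2 * M)) := by gcongr; exact min_le_right _ _
      _ = ε / 2 := by field_simp
  set A := C * |H| + C * ‖v₀‖ + 2 / η
  have hA : 0 < A := by positivity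
  set δ := min 1 (ε / (2 * A))
  have hδ : 0 < δ := by positivity
  have hAδ : A * δ ≤ ε / 2 := by
    calc A * δ ≤ A * (ε / (2 * A)) := by gcongr; exact min_le_right _ _
      _ = ε / 2 := by field_simp
  obtain ⟨W₂, hW₂⟩ := hclose (R + 1) δ hδ
  refine ⟨max (max W₁ W₂) 1, fun ω hω t ht => ?_⟩
  have hω0 : 0 < ω := one_pos.trans_le (le_of_max_le_right hω)
  have hωW := le_of_max_le_left hω
  have hsub : Icc t (t + η) ⊆ Icc (-(R + 1)) (R + 1) :=
    Icc_subset_Icc (by linarith [ht.1]) (by linarith [ht.2, min_le_left 1 (ε / (2 * M))])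
  have hxδ : ∀ s ∈ Icc t (t + η), ‖xω ω s - x s‖ ≤ δ := fun s hs =>
    hW₂ ω (le_of_max_le_right hωW) s (hsub hs)
  have hbound := abs_le_of_lipschitz_of_near_deriv (t := t)
    (q := fun s => ⟪b (xω ω s), deriv (xω ω) s⟫ - h s)
    (G := fun s => ⟪b (xω ω s), xω ω s - x s⟫)
    (c := C * δ * |H| + C * ‖v₀‖ * δ) (δ := δ) hη hM.le
    (fun s _ => (hbd ω hω0 s).inner ℝ
      ((hxd ω hω0 s).sub (hx3.differentiable three_ne_zero s).hasDerivAt))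
    (fun s hs => ?_) (fun s hs => ?_) (fun s hs => ?_)
  · refine hbound.trans ?_
    calc _ = M * η + A * δ := by simp only [A]; ring
      _ ≤ ε := by linarith
  · refine (hL ω (le_of_max_le_left hωW) t (hsub (left_mem_Icc.mpr (by linarith))) s
      (hsub hs)).trans ?_
    gcongr
    exact le_max_left _ _
  · simpa [hbnorm] using (norm_inner_le_norm (𝕜 := ℝ) (b (xω ω s)) (xω ω s - x s)).trans
      (mul_le_mul_of_nonneg_left (hxδ s hs) (norm_nonneg _))
  · obtain ⟨hDb, hbx⟩ := hC s (hsub hs) _ ((hxδ s hs).trans (min_le_left _ _))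
    have hhs : h s = ⟪b (x s), deriv x s⟫ := by
      rw [hxh, inner_smul_right, real_inner_self_eq_norm_sq, hbnorm]; simp
    have hxs : ‖deriv x s‖ ≤ |H| := by
      rw [hxh, norm_smul, hbnorm, mul_one]
      exact (hH s (hsub hs)).trans (le_abs_self _)
    have hsplit : ⟪b (xω ω s), deriv (xω ω) s⟫ - h s
        - (⟪b (xω ω s), deriv (xω ω) s - deriv x s⟫
          + ⟪fderiv ℝ b (xω ω s) (deriv (xω ω) s), xω ω s - x s⟫)
        = ⟪b (xω ω s) - b (x s), deriv x s⟫
          - ⟪fderiv ℝ b (xω ω s) (deriv (xω ω) s), xω ω s - x s⟫ := by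
      rw [hhs, inner_sub_right (b (xω ω s)), inner_sub_left]; ring
    rw [hsplit]
    refine (abs_sub _ _).trans (add_le_add ?_ ?_)
    · refine (abs_real_inner_le_norm _ _).trans ?_
      gcongr
      exact hbx.trans (by gcongr; exact hxδ s hs)
    · refine (abs_real_inner_le_norm _ _).trans ?_
      gcongr
      · exact hDbv ω hω0 s C hDb
      · exact hxδ s hs
end
end
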